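/- Let $W$ be a finite group, let $R$ be the quotient of a finitely generated polynomial algebra over $\QQ$ by a regular sequence, and let $A_\bullet$ be a $\QQ[W]$-CDGA whose homology is isomorphic as a graded $\QQ[W]$-algebra to $R[\beta^{\pm 1}]$ with $|\beta| = 2$, where $R$ sits in degree $0$ and the $W$-action on $R$ and on $\beta$ is trivial. Then $A_\bullet$ is formal as a $\QQ[W]$-CDGA. -/

import Mathlib

/-- A `ℤ`-graded commutative (in the graded sense) differential graded algebra
over `ℚ`: a `ℚ`-algebra with an internal `ℤ`-grading by `ℚ`-submodules, graded
commutativity with Koszul signs, and a degree `-1` differential satisfying the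
signed Leibniz rule. -/
structure CDGA where
  carrier : Type
  [ring : Ring carrier]
  [alg : Algebra ℚ carrier]
  grading : ℤ → Submodule ℚ carrier
  isInternal : DirectSum.IsInternal grading
  one_mem : (1 : carrier) ∈ grading 0
  mul_mem : ∀ {i j : ℤ} {x y : carrier},
    x ∈ grading i → y ∈ grading j → x * y ∈ grading (i + j)
  gcomm : ∀ {i j : ℤ} {x y : carrier}, x ∈ grading i → y ∈ grading j →
    x * y = ((-1 : ℚ) ^ (i * j)) • (y * x)
  d : carrier →ₗ[ℚ] carrier
  d_mem : ∀ {i : ℤ} {x : carrier}, x ∈ grading i → d x ∈ grading (i - 1)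
  d_d : ∀ x : carrier, d (d x) = 0
  leibniz : ∀ {i : ℤ} {x y : carrier}, x ∈ grading i →
    d (x * y) = d x * y + ((-1 : ℚ) ^ i) • (x * d y)

attribute [instance] CDGA.ring CDGA.alg

namespace CDGA

/-- `x` is a boundary in degree `k`, i.e. `x = d z` for some `z` of degree `k + 1`. -/
def IsBoundary (A : CDGA) (k : ℤ) (x : A.carrier) : Prop :=
  ∃ z ∈ A.grading (k + 1), A.d z = x

/-- A morphism of CDGAs: a `ℚ`-algebra homomorphism preserving the grading and
commuting with the differentials. -/
structure Hom (A B : CDGA) where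
  toFun : A.carrier →ₐ[ℚ] B.carrier
  map_grading : ∀ {i : ℤ} {x : A.carrier}, x ∈ A.grading i → toFun x ∈ B.grading i
  map_d : ∀ x : A.carrier, toFun (A.d x) = B.d (toFun x)

/-- A quasi-isomorphism of CDGAs: a morphism inducing an isomorphism on homology
in every degree. -/
def QuasiIso {A B : CDGA} (f : Hom A B) : Prop :=
  ∀ k : ℤ,
    (∀ y ∈ B.grading k, B.d y = 0 →
      ∃ x ∈ A.grading k, A.d x = 0 ∧ B.IsBoundary k (f.toFun x - y)) ∧
    (∀ x ∈ A.grading k, A.d x = 0 → B.IsBoundary k (f.toFun x) → A.IsBoundary k x)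

/-- `β^k` for `k : ℤ`, expressed via `β` and a chosen inverse `β'`. -/
def ipow {R : Type} [Ring R] (β β' : R) (k : ℤ) : R :=
  if 0 ≤ k then β ^ k.toNat else β' ^ (-k).toNat

/-- The homology of `A` is the Laurent algebra `ℚ[β^{±1}]`, `|β| = 2`, with `β` the
class of the cycle `β` (with chosen homology inverse `β'`): odd homology vanishes,
and the homology in degree `2k` is one-dimensional, spanned by the (nonzero) class
of `β^k`. -/
def HomologyIsLaurentOn (A : CDGA) (β β' : A.carrier) : Prop :=
  β ∈ A.grading 2 ∧ β' ∈ A.grading (-2) ∧ A.d β = 0 ∧ A.d β' = 0 ∧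
  A.IsBoundary 0 (β * β' - 1) ∧
  (∀ k : ℤ, ∀ x ∈ A.grading (2 * k + 1), A.d x = 0 → A.IsBoundary (2 * k + 1) x) ∧
  (∀ k : ℤ, ∀ x ∈ A.grading (2 * k), A.d x = 0 →
    ∃ c : ℚ, A.IsBoundary (2 * k) (x - c • ipow β β' k)) ∧
  (∀ k : ℤ, ¬ A.IsBoundary (2 * k) (ipow β β' k))

end CDGA

namespace CDGA

/-- Evaluation of a multivariate polynomial over `ℚ` at a family of elements of a
(possibly noncommutative) `ℚ`-algebra, multiplying the variables in order.  When
the elements pairwise commute (e.g. elements of degree `0` in a CDGA) this is the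
usual evaluation of polynomials. -/
noncomputable def mvEval {R : Type} [Ring R] [Algebra ℚ R] {N : ℕ}
    (a : Fin N → R) (p : MvPolynomial (Fin N) ℚ) : R :=
  ∑ α ∈ p.support, (MvPolynomial.coeff α p) •
    (((List.finRange N).map fun i => a i ^ α i).prod)

end CDGA

open CDGA

/-- `f₁, …, f_m` is a regular sequence in `ℚ[x₁,…,x_N]`: each `f_i` is a
nonzerodivisor modulo its predecessors, and the quotient is nonzero. -/
def IsRegularSeq {N m : ℕ} (f : Fin m → MvPolynomial (Fin N) ℚ) : Prop :=
  Ideal.span (Set.range f) ≠ ⊤ ∧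
  ∀ (i : Fin m) (p : MvPolynomial (Fin N) ℚ),
    f i * p ∈ Ideal.span (f '' {j | j < i}) → p ∈ Ideal.span (f '' {j | j < i})

namespace CDGA

theorem neg_one_zpow_sub_one (i : ℤ) : (-1 : ℚ) ^ (i - 1) = -(-1 : ℚ) ^ i := by
  rw [zpow_sub_one₀ (by norm_num)]
  norm_num

section Graded

variable (A : CDGA)

theorem induction_homogeneous {p : A.carrier → Prop}
    (hom : ∀ (i : ℤ), ∀ x ∈ A.grading i, p x)
    (add : ∀ x y, p x → p y → p (x + y)) (x : A.carrier) : p x := by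
  have hx : x ∈ ⨆ i, A.grading i := by
    rw [A.isInternal.submodule_iSup_eq_top]; trivial
  exact Submodule.iSup_induction _ (motive := p) hx hom (hom 0 0 (zero_mem _)) add

/-- The linear map given by `t i` on the degree `i` part of `A`. -/
noncomputable def ofComponents (t : ℤ → A.carrier →ₗ[ℚ] A.carrier) :
    A.carrier →ₗ[ℚ] A.carrier :=
  (DirectSum.toModule ℚ ℤ A.carrier fun i => (t i).comp (A.grading i).subtype) ∘ₗ
    (LinearEquiv.ofBijective (DirectSum.coeLinearMap A.grading) A.isInternal).symm.toLinearMap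

theorem ofComponents_apply (t : ℤ → A.carrier →ₗ[ℚ] A.carrier) {i : ℤ} {x : A.carrier}
    (hx : x ∈ A.grading i) : A.ofComponents t x = t i x := by
  have h : (LinearEquiv.ofBijective (DirectSum.coeLinearMap A.grading) A.isInternal).symm x =
      DirectSum.lof ℚ ℤ (fun i => A.grading i) i ⟨x, hx⟩ := by
    rw [LinearEquiv.symm_apply_eq]
    exact (DirectSum.coeLinearMap_lof A.grading (i := i) ⟨x, hx⟩).symm
  simp [ofComponents, h]

/-- The grading involution, equal to `(-1) ^ i` in degree `i`. -/
noncomputable def sgn : A.carrier →ₗ[ℚ] A.carrier :=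
  A.ofComponents fun i => ((-1 : ℚ) ^ i) • LinearMap.id

theorem sgn_apply {i : ℤ} {x : A.carrier} (hx : x ∈ A.grading i) :
    A.sgn x = ((-1 : ℚ) ^ i) • x := by
  simp [sgn, A.ofComponents_apply _ hx]

theorem sgn_of_even {i : ℤ} (hi : Even i) {x : A.carrier} (hx : x ∈ A.grading i) :
    A.sgn x = x := by
  rw [A.sgn_apply hx, hi.neg_one_zpow, one_smul]

theorem sgn_mem {i : ℤ} {x : A.carrier} (hx : x ∈ A.grading i) : A.sgn x ∈ A.grading i := by
  rw [A.sgn_apply hx]; exact Submodule.smul_mem _ _ hx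

@[simp]
theorem sgn_sgn (x : A.carrier) : A.sgn (A.sgn x) = x := by
  induction x using A.induction_homogeneous with
  | hom i x hx =>
    rw [A.sgn_apply hx, map_smul, A.sgn_apply hx, smul_smul, ← mul_zpow]
    simp
  | add x y hx hy => simp [hx, hy]

@[simp]
theorem sgn_one : A.sgn 1 = 1 := A.sgn_of_even Even.zero A.one_mem

@[simp]
theorem sgn_mul (x y : A.carrier) : A.sgn (x * y) = A.sgn x * A.sgn y := by
  induction x using A.induction_homogeneous with
  | hom i x hx =>
    induction y using A.induction_homogeneous with
    | hom j y hy =>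
      rw [A.sgn_apply hx, A.sgn_apply hy, A.sgn_apply (A.mul_mem hx hy), smul_mul_smul_comm,
        zpow_add₀ (by norm_num)]
    | add y z hy hz => simp [mul_add, hy, hz]
  | add x z hx hz => simp [add_mul, hx, hz]

theorem sgn_d (x : A.carrier) : A.sgn (A.d x) = -A.d (A.sgn x) := by
  induction x using A.induction_homogeneous with
  | hom i x hx =>
    rw [A.sgn_apply hx, A.sgn_apply (A.d_mem hx), neg_one_zpow_sub_one, map_smul, neg_smul]
  | add x y hx hy => simp only [map_add, hx, hy, neg_add]

theorem d_mul (x y : A.carrier) : A.d (x * y) = A.d x * y + A.sgn x * A.d y := by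
  induction x using A.induction_homogeneous with
  | hom i x hx => rw [A.leibniz hx, A.sgn_apply hx, smul_mul_assoc]
  | add x z hx hz => simp only [add_mul, map_add, hx, hz]; abel

@[simp]
theorem d_one : A.d 1 = 0 := by
  simpa using A.d_mul 1 1

theorem commute_of_sgn_eq {x : A.carrier} (hx : A.sgn x = x) (y : A.carrier) :
    x * y = y * x := by
  have key : ∀ u : A.carrier, (u + A.sgn u) * y = y * (u + A.sgn u) := by
    intro u
    induction u using A.induction_homogeneous with
    | hom i u hu =>
      rcases Int.even_or_odd i with hi | hi
      · rw [A.sgn_of_even hi hu]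
        have : u * y = y * u := by
          induction y using A.induction_homogeneous with
          | hom j y hy => rw [A.gcomm hu hy, (hi.mul_right j).neg_one_zpow, one_smul]
          | add y z hy hz => simp [mul_add, add_mul, hy, hz]
        rw [add_mul, mul_add, this]
      · simp [A.sgn_apply hu, hi.neg_one_zpow]
    | add u v hu hv =>
      rw [map_add, show u + v + (A.sgn u + A.sgn v) = (u + A.sgn u) + (v + A.sgn v) by abel,
        add_mul, mul_add, hu, hv]
  have h := key ((2⁻¹ : ℚ) • x)
  rwa [map_smul, hx, ← add_smul, show (2⁻¹ + 2⁻¹ : ℚ) = 1 by norm_num, one_smul] at h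

/-- The projection to the degree `k` part. -/
noncomputable def proj (k : ℤ) : A.carrier →ₗ[ℚ] A.carrier :=
  A.ofComponents fun i => if i = k then LinearMap.id else 0

theorem proj_apply_of_mem {k : ℤ} {x : A.carrier} (hx : x ∈ A.grading k) :
    A.proj k x = x := by
  simp [proj, A.ofComponents_apply _ hx]

theorem proj_apply_of_ne {i k : ℤ} (h : i ≠ k) {x : A.carrier} (hx : x ∈ A.grading i) :
    A.proj k x = 0 := by
  simp [proj, A.ofComponents_apply _ hx, h]

theorem proj_mem (k : ℤ) (x : A.carrier) : A.proj k x ∈ A.grading k := by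
  induction x using A.induction_homogeneous with
  | hom i x hx =>
    rcases eq_or_ne i k with rfl | h
    · rwa [A.proj_apply_of_mem hx]
    · rw [A.proj_apply_of_ne h hx]; exact zero_mem _
  | add x y hx hy => rw [map_add]; exact add_mem hx hy

theorem proj_d (k : ℤ) (x : A.carrier) : A.proj k (A.d x) = A.d (A.proj (k + 1) x) := by
  induction x using A.induction_homogeneous with
  | hom i x hx =>
    rcases eq_or_ne i (k + 1) with rfl | h
    · rw [A.proj_apply_of_mem hx, A.proj_apply_of_mem (by simpa using A.d_mem hx)]
    · rw [A.proj_apply_of_ne h hx, map_zero,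
        A.proj_apply_of_ne (fun h' => h (by omega)) (A.d_mem hx)]
  | add x y hx hy => simp only [map_add, hx, hy]

theorem isBoundary_iff {k : ℤ} {x : A.carrier} (hx : x ∈ A.grading k) :
    A.IsBoundary k x ↔ x ∈ LinearMap.range A.d := by
  refine ⟨fun ⟨z, _, h⟩ => ⟨z, h⟩, fun ⟨z, h⟩ => ⟨A.proj (k + 1) z, A.proj_mem _ _, ?_⟩⟩
  rw [← A.proj_d, h, A.proj_apply_of_mem hx]

end Graded

namespace Hom

variable {A B : CDGA} (f : Hom A B)

theorem map_sgn (x : A.carrier) : f.toFun (A.sgn x) = B.sgn (f.toFun x) := by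
  induction x using A.induction_homogeneous with
  | hom i x hx => rw [A.sgn_apply hx, B.sgn_apply (f.map_grading hx), map_smul]
  | add x y hx hy => simp only [map_add, hx, hy]

theorem map_proj (k : ℤ) (x : A.carrier) : f.toFun (A.proj k x) = B.proj k (f.toFun x) := by
  induction x using A.induction_homogeneous with
  | hom i x hx =>
    rcases eq_or_ne i k with rfl | h
    · rw [A.proj_apply_of_mem hx, B.proj_apply_of_mem (f.map_grading hx)]
    · rw [A.proj_apply_of_ne h hx, B.proj_apply_of_ne h (f.map_grading hx), map_zero]
  | add x y hx hy => simp only [map_add, hx, hy]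

theorem map_mem_range_d {x : A.carrier} (hx : x ∈ LinearMap.range A.d) :
    f.toFun x ∈ LinearMap.range B.d := by
  obtain ⟨z, rfl⟩ := hx
  exact ⟨f.toFun z, (f.map_d z).symm⟩

/-- The identity morphism. -/
def id (A : CDGA) : Hom A A where
  toFun := AlgHom.id ℚ A.carrier
  map_grading := fun h => h
  map_d := fun _ => rfl

end Hom

/-- The underlying module of the extension `B ⊕ B e` of `B` by an exterior generator `e`
of degree `1`. -/
def OddExt (B : CDGA) : Type := B.carrier × B.carrier

namespace OddExt

variable {B : CDGA}

instance : AddCommGroup (OddExt B) := inferInstanceAs (AddCommGroup (B.carrier × B.carrier))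

instance : Module ℚ (OddExt B) := inferInstanceAs (Module ℚ (B.carrier × B.carrier))

@[ext]
theorem ext {x y : OddExt B} (h₁ : x.1 = y.1) (h₂ : x.2 = y.2) : x = y := Prod.ext h₁ h₂

@[simp] theorem zero_fst : (0 : OddExt B).1 = 0 := rfl
@[simp] theorem zero_snd : (0 : OddExt B).2 = 0 := rfl
@[simp] theorem add_fst (x y : OddExt B) : (x + y).1 = x.1 + y.1 := rfl
@[simp] theorem add_snd (x y : OddExt B) : (x + y).2 = x.2 + y.2 := rfl
@[simp] theorem smul_fst (c : ℚ) (x : OddExt B) : (c • x).1 = c • x.1 := rfl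
@[simp] theorem smul_snd (c : ℚ) (x : OddExt B) : (c • x).2 = c • x.2 := rfl

noncomputable instance : Mul (OddExt B) :=
  ⟨fun x y => (x.1 * y.1, x.1 * y.2 + x.2 * B.sgn y.1)⟩

instance : One (OddExt B) := ⟨((1 : B.carrier), (0 : B.carrier))⟩

@[simp] theorem one_fst : (1 : OddExt B).1 = 1 := rfl
@[simp] theorem one_snd : (1 : OddExt B).2 = 0 := rfl
@[simp] theorem mul_fst (x y : OddExt B) : (x * y).1 = x.1 * y.1 := rfl
@[simp] theorem mul_snd (x y : OddExt B) : (x * y).2 = x.1 * y.2 + x.2 * B.sgn y.1 := rfl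

noncomputable instance : Ring (OddExt B) where
  __ := (inferInstance : AddCommGroup (OddExt B))
  mul_assoc x y z := by ext <;> simp [mul_assoc, mul_add, add_mul, add_assoc]
  one_mul x := by ext <;> simp
  mul_one x := by ext <;> simp
  left_distrib x y z := by
    ext
    · simp [mul_add]
    · simp only [mul_snd, add_fst, add_snd, map_add, mul_add]; abel
  right_distrib x y z := by
    ext
    · simp [add_mul]
    · simp only [mul_snd, add_fst, add_snd, add_mul]; abel
  zero_mul x := by ext <;> simp
  mul_zero x := by ext <;> simp

noncomputable instance : Algebra ℚ (OddExt B) :=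
  Algebra.ofModule (fun c x y => by ext <;> simp) (fun c x y => by ext <;> simp)

/-- The grading on `B ⊕ B e` with `e` in degree `1`. -/
def grading (B : CDGA) (i : ℤ) : Submodule ℚ (OddExt B) :=
  Submodule.prod (B.grading i) (B.grading (i - 1))

/-- The projection to the first summand. -/
def fstₗ (B : CDGA) : OddExt B →ₗ[ℚ] B.carrier := LinearMap.fst ℚ B.carrier B.carrier

/-- The projection to the second summand. -/
def sndₗ (B : CDGA) : OddExt B →ₗ[ℚ] B.carrier := LinearMap.snd ℚ B.carrier B.carrier

/-- The inclusion of the first summand. -/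
def inlₗ (B : CDGA) : B.carrier →ₗ[ℚ] OddExt B := LinearMap.inl ℚ B.carrier B.carrier

/-- The inclusion of the second summand. -/
def inrₗ (B : CDGA) : B.carrier →ₗ[ℚ] OddExt B := LinearMap.inr ℚ B.carrier B.carrier

@[simp] theorem inlₗ_fst (x : B.carrier) : (inlₗ B x).1 = x := rfl
@[simp] theorem inlₗ_snd (x : B.carrier) : (inlₗ B x).2 = 0 := rfl
@[simp] theorem inrₗ_fst (x : B.carrier) : (inrₗ B x).1 = 0 := rfl
@[simp] theorem inrₗ_snd (x : B.carrier) : (inrₗ B x).2 = x := rfl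

theorem isInternal_grading (B : CDGA) : DirectSum.IsInternal (grading B) := by
  have hB := B.isInternal
  rw [DirectSum.isInternal_submodule_iff_iSupIndep_and_iSup_eq_top] at hB ⊢
  refine ⟨fun i => ?_, ?_⟩
  · rw [Submodule.disjoint_def]
    intro x hx hx'
    ext
    · refine Submodule.disjoint_def.1 (hB.1 i) _ hx.1 ?_
      have h := Submodule.mem_map_of_mem (f := fstₗ B) hx'
      simp only [Submodule.map_iSup] at h
      have hle : ⨆ j, ⨆ (_ : j ≠ i), (grading B j).map (fstₗ B) ≤
          ⨆ j, ⨆ (_ : j ≠ i), B.grading j := by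
        refine iSup₂_mono fun j _ => ?_
        rintro _ ⟨y, hy, rfl⟩
        exact hy.1
      exact hle h
    · refine Submodule.disjoint_def.1 (hB.1 (i - 1)) _ hx.2 ?_
      have h := Submodule.mem_map_of_mem (f := sndₗ B) hx'
      simp only [Submodule.map_iSup] at h
      have hle : ⨆ j, ⨆ (_ : j ≠ i), (grading B j).map (sndₗ B) ≤
          ⨆ j, ⨆ (_ : j ≠ i - 1), B.grading j := by
        refine iSup₂_le fun j hj => ?_
        refine le_trans ?_ (le_iSup₂ (f := fun j (_ : j ≠ i - 1) => B.grading j) (j - 1) (by omega))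
        rintro _ ⟨y, hy, rfl⟩
        exact hy.2
      exact hle h
  · rw [eq_top_iff]
    intro x _
    have h₁ : ∀ y : B.carrier, inlₗ B y ∈ ⨆ i, grading B i := fun y => by
      induction y using B.induction_homogeneous with
      | hom i y hy => exact Submodule.mem_iSup_of_mem i ⟨hy, zero_mem _⟩
      | add y z hy hz => rw [map_add]; exact add_mem hy hz
    have h₂ : ∀ y : B.carrier, inrₗ B y ∈ ⨆ i, grading B i := fun y => by
      induction y using B.induction_homogeneous with
      | hom i y hy => exact Submodule.mem_iSup_of_mem (i + 1) ⟨zero_mem _, by simpa using hy⟩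
      | add y z hy hz => rw [map_add]; exact add_mem hy hz
    have hx : x = inlₗ B x.1 + inrₗ B x.2 := by ext <;> simp
    rw [hx]
    exact add_mem (h₁ _) (h₂ _)

/-- The differential on `B ⊕ B e` with `d e = b`. -/
noncomputable def diff (b : B.carrier) : OddExt B →ₗ[ℚ] OddExt B :=
  inlₗ B ∘ₗ (B.d ∘ₗ fstₗ B + LinearMap.mulRight ℚ b ∘ₗ B.sgn ∘ₗ sndₗ B) +
    inrₗ B ∘ₗ B.d ∘ₗ sndₗ B

@[simp]
theorem diff_fst (b : B.carrier) (x : OddExt B) :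
    (diff b x).1 = B.d x.1 + B.sgn x.2 * b := by
  change (B.d x.1 + B.sgn x.2 * b) + 0 = _
  rw [add_zero]

@[simp]
theorem diff_snd (b : B.carrier) (x : OddExt B) : (diff b x).2 = B.d x.2 := by
  change 0 + B.d x.2 = _
  rw [zero_add]

end OddExt

/-- The CDGA obtained from `B` by adjoining an exterior generator `e` of degree `1` with
`d e = b`, for a cycle `b` of degree `0`. -/
noncomputable def adjoin (B : CDGA) (b : B.carrier) (hb : b ∈ B.grading 0) (hdb : B.d b = 0) :
    CDGA where
  carrier := OddExt B
  grading := OddExt.grading B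
  isInternal := OddExt.isInternal_grading B
  one_mem := ⟨B.one_mem, zero_mem _⟩
  mul_mem := by
    intro i j x y hx hy
    refine ⟨B.mul_mem hx.1 hy.1, add_mem ?_ ?_⟩
    · simpa [add_sub_assoc] using B.mul_mem hx.1 hy.2
    · simpa [sub_add_eq_add_sub] using B.mul_mem hx.2 (B.sgn_mem hy.1)
  gcomm := by
    intro i j x y hx hy
    have h2 : ∀ n : ℤ, (-1 : ℚ) ^ n * (-1 : ℚ) ^ n = 1 := fun n => by
      rw [← mul_zpow]; simp
    have hne : (-1 : ℚ) ≠ 0 := by norm_num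
    ext
    · simp [B.gcomm hx.1 hy.1]
    · simp only [OddExt.mul_snd, OddExt.smul_snd, B.sgn_apply hx.1, B.sgn_apply hy.1,
        mul_smul_comm, smul_add, smul_smul]
      rw [B.gcomm hx.1 hy.2, B.gcomm hx.2 hy.1, add_comm, smul_smul]
      congr 2
      · rw [← zpow_add₀ hne]; ring_nf
      · rw [mul_sub, mul_one, zpow_sub₀ hne, div_eq_iff (zpow_ne_zero _ hne), mul_assoc, h2,
          mul_one]
  d := OddExt.diff b
  d_mem := by
    intro i x hx
    refine ⟨?_, ?_⟩
    · rw [OddExt.diff_fst]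
      exact add_mem (B.d_mem hx.1) (by simpa using B.mul_mem (B.sgn_mem hx.2) hb)
    · rw [OddExt.diff_snd]
      exact B.d_mem hx.2
  d_d x := by
    ext
    · simp [B.d_d, B.d_mul, hdb, B.sgn_d]
    · simp [B.d_d]
  leibniz := by
    intro i x y hx
    have hsb : B.sgn b = b := B.sgn_of_even Even.zero hb
    have hcomm := B.commute_of_sgn_eq hsb
    have e1 : ∀ u, ((-1 : ℚ) ^ i) • (x.1 * u) = B.sgn x.1 * u := fun u => by
      rw [B.sgn_apply hx.1, smul_mul_assoc]
    have e2 : ∀ u, ((-1 : ℚ) ^ i) • (x.2 * u) = - (B.sgn x.2 * u) := fun u => by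
      rw [B.sgn_apply hx.2, smul_mul_assoc, neg_one_zpow_sub_one, neg_smul, neg_neg]
    ext
    · simp only [OddExt.diff_fst, OddExt.add_fst, OddExt.mul_fst, OddExt.mul_snd,
        OddExt.smul_fst, e1, B.d_mul, map_add, B.sgn_mul, B.sgn_sgn]
      rw [add_mul, add_mul, mul_add, mul_assoc (B.sgn x.2) b, hcomm]
      simp only [mul_assoc]
      abel
    · simp only [OddExt.diff_fst, OddExt.diff_snd, OddExt.add_snd, OddExt.mul_snd,
        OddExt.smul_snd, smul_add, e1, e2, B.d_mul, map_add, B.sgn_mul, B.sgn_sgn, B.sgn_d, hsb]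
      rw [add_mul, mul_assoc (B.sgn x.2) b, hcomm]
      simp only [mul_add, mul_neg]
      abel

theorem mul_eq_sgn_mul_of_mem_one (A : CDGA) {z : A.carrier} (hz : z ∈ A.grading 1)
    (y : A.carrier) : z * y = A.sgn y * z := by
  induction y using A.induction_homogeneous with
  | hom j y hy => rw [A.gcomm hz hy, one_mul, A.sgn_apply hy, smul_mul_assoc]
  | add x y hx hy => rw [mul_add, map_add, add_mul, hx, hy]

theorem mul_self_of_mem_one (A : CDGA) {z : A.carrier} (hz : z ∈ A.grading 1) :
    z * z = 0 := by
  have h := A.mul_eq_sgn_mul_of_mem_one hz z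
  rw [A.sgn_apply hz, zpow_one, neg_one_smul, neg_mul] at h
  have h2 : (2 : ℚ) • (z * z) = 0 := by rw [two_smul]; nth_rewrite 1 [h]; exact neg_add_cancel _
  exact (smul_eq_zero.1 h2).resolve_left two_ne_zero

/-- The inclusion of the first summand as a map of algebras. -/
noncomputable def OddExt.inlₐ (B : CDGA) : B.carrier →ₐ[ℚ] OddExt B :=
  AlgHom.ofLinearMap (OddExt.inlₗ B) rfl fun x y => by ext <;> simp

section Adjoin

variable {B C : CDGA} {b : B.carrier} (hb : b ∈ B.grading 0) (hdb : B.d b = 0)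

/-- The inclusion of `B` into `B ⊕ B e`. -/
noncomputable def adjoinIncl : Hom B (B.adjoin b hb hdb) where
  toFun := OddExt.inlₐ B
  map_grading h := ⟨h, zero_mem _⟩
  map_d x := by
    change OddExt.inlₗ B (B.d x) = OddExt.diff b (OddExt.inlₗ B x)
    ext <;> simp

/-- The extension of a morphism `h : B → C` to `B ⊕ B e` with `e ↦ z`, where `d z = h b`. -/
noncomputable def adjoinLift (h : Hom B C) {z : C.carrier} (hz : z ∈ C.grading 1)
    (hdz : C.d z = h.toFun b) : Hom (B.adjoin b hb hdb) C where
  toFun := AlgHom.ofLinearMap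
    (h.toFun.toLinearMap ∘ₗ OddExt.fstₗ B +
      LinearMap.mulRight ℚ z ∘ₗ h.toFun.toLinearMap ∘ₗ OddExt.sndₗ B)
    (by
      change h.toFun 1 + h.toFun 0 * z = 1
      simp)
    (fun x y => by
      change h.toFun (x.1 * y.1) + h.toFun (x.1 * y.2 + x.2 * B.sgn y.1) * z =
        (h.toFun x.1 + h.toFun x.2 * z) * (h.toFun y.1 + h.toFun y.2 * z)
      have hzz : ∀ u v, u * z * (v * z) = 0 := fun u v => by
        rw [mul_assoc, ← mul_assoc z, C.mul_eq_sgn_mul_of_mem_one hz, mul_assoc _ z,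
          C.mul_self_of_mem_one hz, mul_zero, mul_zero]
      rw [add_mul, mul_add, mul_add, hzz, mul_assoc _ z, C.mul_eq_sgn_mul_of_mem_one hz]
      simp only [map_mul, map_add, h.map_sgn, add_mul, mul_assoc]
      abel)
  map_grading {i x} hx := by
    refine add_mem (h.map_grading hx.1) ?_
    have h' := C.mul_mem (h.map_grading hx.2) hz
    rwa [sub_add_cancel] at h'
  map_d := fun (x : OddExt B) => by
    change h.toFun (OddExt.diff b x).1 + h.toFun (OddExt.diff b x).2 * z =
      C.d (h.toFun x.1 + h.toFun x.2 * z)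
    rw [OddExt.diff_fst, OddExt.diff_snd]
    simp only [map_add, map_mul, h.map_d, h.map_sgn, C.d_mul, hdz]
    abel

theorem adjoinLift_apply (h : Hom B C) {z : C.carrier} (hz : z ∈ C.grading 1)
    (hdz : C.d z = h.toFun b) (x : OddExt B) :
    (adjoinLift hb hdb h hz hdz).toFun x = h.toFun x.1 + h.toFun x.2 * z := rfl

end Adjoin

/-- `D` with its maps `ι`, `f`, `g` has homology `P / I`, is compatible with `φ : P → A` and
`π : P → L`, and maps to `A` with image in `U`. -/
structure IsResolution {P A L D : CDGA} (φ : Hom P A) (π : Hom P L)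
    (U : Subalgebra ℚ A.carrier) (I : Set P.carrier)
    (ι : Hom P D) (f : Hom D A) (g : Hom D L) : Prop where
  f_ι : ∀ p, f.toFun (ι.toFun p) = φ.toFun p
  g_ι : ∀ p, g.toFun (ι.toFun p) = π.toFun p
  f_mem : ∀ x, f.toFun x ∈ U
  surj : ∀ x, D.d x = 0 → ∃ p, x - ι.toFun p ∈ LinearMap.range D.d
  ker : ∀ p, ι.toFun p ∈ LinearMap.range D.d ↔ p ∈ I

/-- There is a resolution of `P / I` over `A` and `L`. -/
def HasResolution {P A L : CDGA} (φ : Hom P A) (π : Hom P L)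
    (U : Subalgebra ℚ A.carrier) (I : Set P.carrier) : Prop :=
  ∃ (D : CDGA) (ι : Hom P D) (f : Hom D A) (g : Hom D L), IsResolution φ π U I ι f g

theorem hasResolution_zero {P A L : CDGA} (hd : P.d = 0) (φ : Hom P A) (π : Hom P L)
    (U : Subalgebra ℚ A.carrier) (hU : ∀ p, φ.toFun p ∈ U) : HasResolution φ π U {0} :=
  ⟨P, Hom.id P, φ, π, fun _ => rfl, fun _ => rfl, hU,
    fun x _ => ⟨x, by simp [Hom.id]⟩, fun p => by simp [Hom.id, hd]⟩

theorem HasResolution.adjoin {P A L : CDGA} (hd : P.d = 0) (hP : ∀ p, P.sgn p = p)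
    {φ : Hom P A} {π : Hom P L} {U : Subalgebra ℚ A.carrier} {I I' : Set P.carrier}
    (H : HasResolution φ π U I) {q : P.carrier} (hq : q ∈ P.grading 0)
    {z : A.carrier} (hz : z ∈ A.grading 1) (hzU : z ∈ U) (hdz : A.d z = φ.toFun q)
    (hπ : π.toFun q = 0) (hreg : ∀ p, p * q ∈ I → p ∈ I)
    (hI' : ∀ p, p ∈ I' ↔ ∃ r, p - r * q ∈ I) : HasResolution φ π U I' := by
  obtain ⟨B, ι, f, g, H⟩ := H
  set b := ι.toFun q with hbdef
  have hb : b ∈ B.grading 0 := ι.map_grading hq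
  have hdι : ∀ p, B.d (ι.toFun p) = 0 := fun p => by rw [← ι.map_d, hd]; simp
  have hsι : ∀ p, B.sgn (ι.toFun p) = ι.toFun p := fun p => by rw [← ι.map_sgn, hP]
  have hdb : B.d b = 0 := hdι q
  have hdm : ∀ w, B.d (w * b) = B.d w * b := fun w => by
    rw [B.d_mul, hdb, mul_zero, add_zero]
  refine ⟨B.adjoin b hb hdb,
    ⟨(adjoinIncl hb hdb).toFun.comp ι.toFun,
      fun h => (adjoinIncl hb hdb).map_grading (ι.map_grading h),
      fun x => ?_⟩,
    adjoinLift hb hdb f hz (hdz.trans (H.f_ι q).symm),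
    adjoinLift hb hdb g (zero_mem _) ?_, ?_⟩
  · simp only [AlgHom.comp_apply, ι.map_d, (adjoinIncl hb hdb).map_d]
  · rw [map_zero, hbdef, H.g_ι, hπ]
  have hι : ∀ p, (adjoinIncl hb hdb).toFun (ι.toFun p) = OddExt.inlₗ B (ι.toFun p) := fun _ => rfl
  constructor
  · intro p
    simp [hι, adjoinLift_apply, H.f_ι]
  · intro p
    simp [hι, adjoinLift_apply, H.g_ι]
  · intro x
    change f.toFun x.1 + f.toFun x.2 * z ∈ U
    exact U.add_mem (H.f_mem _) (U.mul_mem (H.f_mem _) hzU)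
  · intro (x : OddExt B) (hx : OddExt.diff b x = 0)
    have h1 : B.d x.1 + B.sgn x.2 * b = 0 := by rw [← OddExt.diff_fst, hx]; rfl
    have h2 : B.d x.2 = 0 := by rw [← OddExt.diff_snd b, hx]; rfl
    obtain ⟨p, w, hw⟩ := H.surj _ h2
    have hu : x.2 = ι.toFun p + B.d w := by rw [hw]; abel
    have hp : p ∈ I := by
      refine hreg p ((H.ker _).1 ⟨-x.1 + B.sgn w * b, ?_⟩)
      rw [hu, map_add, hsι, B.sgn_d, add_mul, neg_mul] at h1
      rw [map_mul, map_add, map_neg, hdm, ← hbdef, eq_comm, ← sub_eq_zero, ← h1]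
      abel
    obtain ⟨v, hv⟩ := (H.ker p).2 hp
    have hc : B.d (x.1 - B.sgn (v + w) * b) = 0 := by
      have : B.sgn x.2 = - B.d (B.sgn (v + w)) := by
        rw [hu, ← hv, ← map_add, B.sgn_d]
      rw [map_sub, hdm, ← h1, this, neg_mul]
      abel
    obtain ⟨p', w', hw'⟩ := H.surj _ hc
    refine ⟨p', OddExt.inlₗ B w' + OddExt.inrₗ B (v + w), ?_⟩
    change OddExt.diff b _ = x - OddExt.inlₗ B (ι.toFun p')
    rw [eq_sub_iff_add_eq]
    ext
    · simp only [OddExt.add_fst, OddExt.diff_fst, OddExt.add_snd, OddExt.inlₗ_fst,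
        OddExt.inlₗ_snd, OddExt.inrₗ_fst, OddExt.inrₗ_snd, add_zero, zero_add, hw']
      abel
    · simp [hv, hu]
  · intro p
    rw [hI']
    constructor
    · rintro ⟨(x : OddExt B), (hx : OddExt.diff b x = OddExt.inlₗ B (ι.toFun p))⟩
      have h1 : B.d x.1 + B.sgn x.2 * b = ι.toFun p := by rw [← OddExt.diff_fst, hx]; rfl
      have h2 : B.d x.2 = 0 := by rw [← OddExt.diff_snd b, hx]; rfl
      obtain ⟨r, w, hw⟩ := H.surj _ h2
      have hu : x.2 = ι.toFun r + B.d w := by rw [hw]; abel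
      refine ⟨r, (H.ker _).1 ⟨x.1 - B.sgn w * b, ?_⟩⟩
      rw [hu, map_add, hsι, B.sgn_d, add_mul, neg_mul] at h1
      rw [map_sub, hdm, map_sub, map_mul, ← h1, ← hbdef]
      abel
    · rintro ⟨r, hr⟩
      obtain ⟨x, hx⟩ := (H.ker _).2 hr
      refine ⟨OddExt.inlₗ B x + OddExt.inrₗ B (ι.toFun r), ?_⟩
      change OddExt.diff b _ = OddExt.inlₗ B (ι.toFun p)
      ext
      · simp [hx, hsι, hbdef]
      · simp [hdι]

/-- A criterion for a map out of a resolution to be a quasi-isomorphism. -/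
theorem quasiIso_of_cover {P D C : CDGA} {φ : Hom P C} {ι : Hom P D} {f : Hom D C}
    (hf : ∀ p, f.toFun (ι.toFun p) = φ.toFun p) (hd : P.d = 0)
    (hD : ∀ x, D.d x = 0 → ∃ p, x - ι.toFun p ∈ LinearMap.range D.d)
    (hsurj : ∀ k, ∀ y ∈ C.grading k, C.d y = 0 →
      ∃ p ∈ P.grading k, y - φ.toFun p ∈ LinearMap.range C.d)
    (hinj : ∀ k, ∀ p ∈ P.grading k, φ.toFun p ∈ LinearMap.range C.d →
      ι.toFun p ∈ LinearMap.range D.d) : QuasiIso f := by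
  refine fun k => ⟨fun y hy hdy => ?_, fun x hx hdx hfx => ?_⟩
  · obtain ⟨p, hp, h⟩ := hsurj k y hy hdy
    refine ⟨ι.toFun p, ι.map_grading hp, by rw [← ι.map_d, hd]; simp, ?_⟩
    rw [C.isBoundary_iff (sub_mem (f.map_grading (ι.map_grading hp)) hy), hf, ← neg_sub]
    exact neg_mem h
  · rw [C.isBoundary_iff (f.map_grading hx)] at hfx
    rw [D.isBoundary_iff hx]
    obtain ⟨p, w, hw⟩ := hD x hdx
    have h : x - ι.toFun (P.proj k p) ∈ LinearMap.range D.d := by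
      refine ⟨D.proj (k + 1) w, ?_⟩
      rw [← D.proj_d, hw, map_sub, D.proj_apply_of_mem hx, ι.map_proj]
    have hι : ι.toFun (P.proj k p) ∈ LinearMap.range D.d := by
      refine hinj k _ (P.proj_mem k p) ?_
      rw [← hf]
      have := sub_mem hfx (f.map_mem_range_d h)
      rwa [map_sub, sub_sub_cancel] at this
    simpa using add_mem h hι

/-- A commutative `ℚ`-algebra graded in even degrees, as a CDGA with zero differential. -/
def ofEven (R : Type) [CommRing R] [Algebra ℚ R] (𝒜 : ℤ → Submodule ℚ R)
    (internal : DirectSum.IsInternal 𝒜) (one_mem : (1 : R) ∈ 𝒜 0)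
    (mul_mem : ∀ {i j : ℤ} {x y : R}, x ∈ 𝒜 i → y ∈ 𝒜 j → x * y ∈ 𝒜 (i + j))
    (odd : ∀ k, Odd k → 𝒜 k = ⊥) : CDGA where
  carrier := R
  grading := 𝒜
  isInternal := internal
  one_mem := one_mem
  mul_mem := mul_mem
  gcomm := by
    intro i j x y hx hy
    rcases Int.even_or_odd i with hi | hi
    · rw [(hi.mul_right j).neg_one_zpow, one_smul, mul_comm]
    · rw [odd i hi, Submodule.mem_bot] at hx
      simp [hx]
  d := 0
  d_mem := fun _ => Submodule.zero_mem _
  d_d := fun _ => rfl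
  leibniz := by simp

theorem sgn_eq_of_odd_eq_bot (P : CDGA) (odd : ∀ k, Odd k → P.grading k = ⊥) (p : P.carrier) :
    P.sgn p = p := by
  induction p using P.induction_homogeneous with
  | hom i p hp =>
    rcases Int.even_or_odd i with hi | hi
    · exact P.sgn_of_even hi hp
    · rw [odd i hi, Submodule.mem_bot] at hp
      simp [hp]
  | add x y hx hy => rw [map_add, hx, hy]

/-- The cycles fixed by the grading involution. -/
noncomputable def evenCycles (A : CDGA) : Subalgebra ℚ A.carrier where
  carrier := {x | A.sgn x = x ∧ A.d x = 0}
  mul_mem' := fun ⟨hx, hx'⟩ ⟨hy, hy'⟩ => by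
    constructor
    · rw [A.sgn_mul, hx, hy]
    · rw [A.d_mul, hx', hy', zero_mul, mul_zero, add_zero]
  add_mem' := fun ⟨hx, hx'⟩ ⟨hy, hy'⟩ => by
    constructor
    · rw [map_add, hx, hy]
    · rw [map_add, hx', hy', add_zero]
  algebraMap_mem' r := by
    rw [Algebra.algebraMap_eq_smul_one]
    constructor
    · rw [map_smul, A.sgn_one]
    · rw [map_smul, A.d_one, smul_zero]

noncomputable instance (A : CDGA) : CommRing A.evenCycles where
  __ := A.evenCycles.toRing
  mul_comm x y := Subtype.ext (A.commute_of_sgn_eq x.2.1 y.1)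

theorem mem_evenCycles (A : CDGA) {i : ℤ} (hi : Even i) {x : A.carrier} (hx : x ∈ A.grading i)
    (hdx : A.d x = 0) : x ∈ A.evenCycles :=
  ⟨A.sgn_of_even hi hx, hdx⟩

/-- The ideal of boundaries in the even cycles. -/
def evenBoundaries (A : CDGA) : Ideal A.evenCycles where
  carrier := {x | x.1 ∈ LinearMap.range A.d}
  add_mem' hx hy := (LinearMap.range A.d).add_mem hx hy
  zero_mem' := (LinearMap.range A.d).zero_mem
  smul_mem' := by
    rintro c x ⟨z, hz⟩
    refine ⟨c.1 * z, ?_⟩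
    rw [A.d_mul, c.2.2, c.2.1, zero_mul, zero_add, hz]
    rfl

theorem mvEval_comp_X {R : Type} [Ring R] [Algebra ℚ R] {N : ℕ}
    (ψ : MvPolynomial (Fin N) ℚ →ₐ[ℚ] R) (p : MvPolynomial (Fin N) ℚ) :
    mvEval (fun i => ψ (MvPolynomial.X i)) p = ψ p := by
  conv_rhs => rw [p.as_sum, map_sum]
  refine Finset.sum_congr rfl fun α _ => ?_
  rw [MvPolynomial.monomial_eq, Finsupp.prod_fintype _ _ (by simp), MvPolynomial.C_mul', map_smul,
    Fin.prod_univ_def, map_list_prod, List.map_map]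
  simp [Function.comp_def]

theorem map_ipow {R S : Type} [Ring R] [Ring S] (f : R →+* S) (x y : R) (k : ℤ) :
    f (ipow x y k) = ipow (f x) (f y) k := by
  unfold ipow
  split_ifs <;> simp

theorem isInternal_restrictScalars {R M : Type} [Ring R] [Algebra ℚ R] [AddCommGroup M]
    [Module R M] [Module ℚ M] [IsScalarTower ℚ R M] {𝒜 : ℤ → Submodule R M}
    (h : DirectSum.IsInternal 𝒜) :
    DirectSum.IsInternal fun k => (𝒜 k).restrictScalars ℚ :=
  h

section Cover

open MvPolynomial

/-- The weights `2` and `-2` of the two generators of `cover`. -/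
def coverWeight : Fin 2 → ℤ := ![2, -2]

theorem weight_coverWeight (α : Fin 2 →₀ ℕ) :
    Finsupp.weight coverWeight α = 2 * ((α 0 : ℤ) - α 1) := by
  rw [Finsupp.weight_apply, Finsupp.sum_fintype _ _ (by simp)]
  simp [coverWeight]
  ring

theorem eq_zero_of_isWeightedHomogeneous_odd {N : ℕ} {k : ℤ} (hk : Odd k)
    {p : MvPolynomial (Fin 2) (MvPolynomial (Fin N) ℚ)}
    (hp : IsWeightedHomogeneous coverWeight p k) : p = 0 := by
  refine MvPolynomial.ext _ _ fun α => ?_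
  by_contra h
  have h' := hp h
  rw [weight_coverWeight] at h'
  obtain ⟨m, rfl⟩ := hk
  omega

/-- The polynomial algebra `ℚ[x₁,…,x_N][γ, γ']` with `γ`, `γ'` in degrees `2`, `-2`. -/
noncomputable def cover (N : ℕ) : CDGA :=
  ofEven (MvPolynomial (Fin 2) (MvPolynomial (Fin N) ℚ))
    (fun k => (weightedHomogeneousSubmodule _ coverWeight k).restrictScalars ℚ)
    (isInternal_restrictScalars (@DirectSum.Decomposition.isInternal _ _ _ _ _ _ _ _
      (weightedGradedAlgebra (MvPolynomial (Fin N) ℚ) coverWeight).toDecomposition))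
    (isWeightedHomogeneous_one _ _)
    (fun hx hy => IsWeightedHomogeneous.mul hx hy)
    (fun k hk => by
      rw [eq_bot_iff]
      exact fun p hp => eq_zero_of_isWeightedHomogeneous_odd hk hp)

theorem cover_d (N : ℕ) : (cover N).d = 0 := rfl

theorem mem_cover_grading {N : ℕ} {k : ℤ} {p : MvPolynomial (Fin 2) (MvPolynomial (Fin N) ℚ)} :
    p ∈ (cover N).grading k ↔ IsWeightedHomogeneous coverWeight p k := Iff.rfl

theorem cover_grading_odd (N : ℕ) (k : ℤ) (hk : Odd k) : (cover N).grading k = ⊥ := by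
  rw [eq_bot_iff]
  exact fun p hp => eq_zero_of_isWeightedHomogeneous_odd hk hp

theorem cover_sgn (N : ℕ) (p : (cover N).carrier) : (cover N).sgn p = p :=
  sgn_eq_of_odd_eq_bot _ (cover_grading_odd N) p

/-- The relation `1 - γ γ'`. -/
noncomputable def invRel (N : ℕ) : MvPolynomial (Fin 2) (MvPolynomial (Fin N) ℚ) :=
  1 - X 0 * X 1

/-- The element `s γ ^ k`, where negative powers of `γ` are powers of `γ'`. -/
noncomputable def coverTerm {N : ℕ} (s : MvPolynomial (Fin N) ℚ) (k : ℤ) :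
    MvPolynomial (Fin 2) (MvPolynomial (Fin N) ℚ) :=
  C s * ipow (X 0) (X 1) k

theorem X_zero_mem (N : ℕ) :
    (X 0 : MvPolynomial (Fin 2) (MvPolynomial (Fin N) ℚ)) ∈ (cover N).grading 2 :=
  isWeightedHomogeneous_X _ coverWeight 0

theorem X_one_mem (N : ℕ) :
    (X 1 : MvPolynomial (Fin 2) (MvPolynomial (Fin N) ℚ)) ∈ (cover N).grading (-2) :=
  isWeightedHomogeneous_X _ coverWeight 1

theorem C_mem {N : ℕ} (s : MvPolynomial (Fin N) ℚ) :
    (C s : MvPolynomial (Fin 2) (MvPolynomial (Fin N) ℚ)) ∈ (cover N).grading 0 :=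
  isWeightedHomogeneous_C coverWeight s

theorem invRel_mem (N : ℕ) : invRel N ∈ (cover N).grading 0 :=
  sub_mem (S := Submodule ℚ (cover N).carrier) (cover N).one_mem
    ((cover N).mul_mem (X_zero_mem N) (X_one_mem N))

theorem pow_mem (A : CDGA) {i : ℤ} {x : A.carrier} (hx : x ∈ A.grading i) (n : ℕ) :
    x ^ n ∈ A.grading (n * i) := by
  induction n with
  | zero => simpa using A.one_mem
  | succ n ih =>
    rw [pow_succ]
    convert A.mul_mem ih hx using 2
    push_cast
    ring

theorem ipow_mem (A : CDGA) {x y : A.carrier} (hx : x ∈ A.grading 2) (hy : y ∈ A.grading (-2))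
    (k : ℤ) : ipow x y k ∈ A.grading (2 * k) := by
  unfold ipow
  split_ifs with h
  · convert A.pow_mem hx k.toNat using 2
    omega
  · convert A.pow_mem hy (-k).toNat using 2
    omega

theorem coverTerm_mem {N : ℕ} (s : MvPolynomial (Fin N) ℚ) (k : ℤ) :
    coverTerm s k ∈ (cover N).grading (2 * k) := by
  have h := (cover N).mul_mem (C_mem s) ((cover N).ipow_mem (X_zero_mem N) (X_one_mem N) k)
  rwa [zero_add] at h

theorem invRel_dvd_monomial_sub {N : ℕ} {α : Fin 2 →₀ ℕ} {k : ℤ} (h : (α 0 : ℤ) - α 1 = k)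
    (s : MvPolynomial (Fin N) ℚ) : invRel N ∣ monomial α s - coverTerm s k := by
  have key : ∀ n, invRel N ∣ (X 0 * X 1) ^ n - 1 := fun n => by
    have := sub_dvd_pow_sub_pow (X 0 * X 1 : MvPolynomial (Fin 2) (MvPolynomial (Fin N) ℚ)) 1 n
    rw [one_pow] at this
    obtain ⟨c, hc⟩ := this
    exact ⟨-c, by rw [hc, invRel]; ring⟩
  rw [monomial_eq, Finsupp.prod_fintype _ _ (by simp), Fin.prod_univ_two, coverTerm, ← mul_sub]
  refine Dvd.dvd.mul_left ?_ _
  unfold ipow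
  split_ifs with hk
  · obtain ⟨n, rfl⟩ := Int.eq_ofNat_of_zero_le hk
    have : α 0 = n + α 1 := by omega
    rw [this, Int.toNat_natCast]
    convert (key (α 1)).mul_left (X 0 ^ n) using 1
    ring
  · obtain ⟨n, hn⟩ := Int.eq_ofNat_of_zero_le (show 0 ≤ -k by omega)
    have : α 1 = n + α 0 := by omega
    rw [this, hn, Int.toNat_natCast]
    convert (key (α 0)).mul_left (X 1 ^ n) using 1
    ring

theorem exists_invRel_dvd_sub_coverTerm {N : ℕ} {k : ℤ}
    {p : MvPolynomial (Fin 2) (MvPolynomial (Fin N) ℚ)} (hp : p ∈ (cover N).grading (2 * k)) :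
    ∃ s, invRel N ∣ p - coverTerm s k := by
  refine ⟨∑ α ∈ p.support, p.coeff α, ?_⟩
  have h : p - coverTerm (∑ α ∈ p.support, p.coeff α) k =
      ∑ α ∈ p.support, (monomial α (p.coeff α) - coverTerm (p.coeff α) k) := by
    rw [Finset.sum_sub_distrib, ← p.as_sum]
    simp only [coverTerm, map_sum, Finset.sum_mul]
  rw [h]
  refine Finset.dvd_sum fun α hα => invRel_dvd_monomial_sub ?_ _
  have := mem_cover_grading.1 hp (mem_support_iff.1 hα)
  rw [weight_coverWeight] at this
  omega

theorem mem_map_C_of_mul_invRel_mem {N : ℕ} {I : Ideal (MvPolynomial (Fin N) ℚ)}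
    {p : MvPolynomial (Fin 2) (MvPolynomial (Fin N) ℚ)}
    (hp : p * invRel N ∈ I.map (C : _ →+* MvPolynomial (Fin 2) (MvPolynomial (Fin N) ℚ))) :
    p ∈ I.map (C : _ →+* MvPolynomial (Fin 2) (MvPolynomial (Fin N) ℚ)) := by
  rw [mem_map_C_iff] at hp ⊢
  have hm : (X 0 * X 1 : MvPolynomial (Fin 2) (MvPolynomial (Fin N) ℚ)) =
      monomial (Finsupp.single 0 1 + Finsupp.single 1 1) 1 := by
    rw [X, X, monomial_mul, one_mul]
  have key : ∀ (n : ℕ) (α : Fin 2 →₀ ℕ), α 0 = n → p.coeff α ∈ I := by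
    intro n
    induction n with
    | zero =>
      intro α hα
      have h := hp α
      rw [invRel, mul_sub, mul_one, coeff_sub, hm, coeff_mul_monomial', if_neg, sub_zero] at h
      · exact h
      · intro hle
        have := hle 0
        simp [hα] at this
    | succ n ih =>
      intro α hα
      have h := hp α
      rw [invRel, mul_sub, mul_one, coeff_sub, hm, coeff_mul_monomial'] at h
      split_ifs at h with hle
      · rw [mul_one] at h
        have h' := ih (α - (Finsupp.single 0 1 + Finsupp.single 1 1)) (by simp [hα])
        simpa using add_mem h h'
      · simpa using h
  exact fun α => key _ α rfl

end Cover

section Eval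

open MvPolynomial

variable {C : CDGA} {N : ℕ}

/-- Generators for a map from `cover N` to `C`: cycles of degrees `0`, `2` and `-2`. -/
structure IsCoverData (C : CDGA) {N : ℕ} (a : Fin N → C.carrier) (β β' : C.carrier) : Prop where
  a_mem : ∀ i, a i ∈ C.grading 0
  d_a : ∀ i, C.d (a i) = 0
  β_mem : β ∈ C.grading 2
  d_β : C.d β = 0
  β'_mem : β' ∈ C.grading (-2)
  d_β' : C.d β' = 0

variable {a : Fin N → C.carrier} {β β' : C.carrier}

/-- Evaluation of polynomials in `x₁,…,x_N` in the even cycles. -/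
noncomputable def IsCoverData.baseEval (h : IsCoverData C a β β') :
    MvPolynomial (Fin N) ℚ →ₐ[ℚ] C.evenCycles :=
  aeval fun i => ⟨a i, C.mem_evenCycles Even.zero (h.a_mem i) (h.d_a i)⟩

/-- Evaluation of elements of `cover N` in the even cycles. -/
noncomputable def IsCoverData.eval (h : IsCoverData C a β β') :
    MvPolynomial (Fin 2) (MvPolynomial (Fin N) ℚ) →+* C.evenCycles :=
  eval₂Hom h.baseEval.toRingHom
    ![⟨β, C.mem_evenCycles even_two h.β_mem h.d_β⟩,
      ⟨β', C.mem_evenCycles even_two.neg h.β'_mem h.d_β'⟩]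

theorem IsCoverData.eval_C (h : IsCoverData C a β β') (s : MvPolynomial (Fin N) ℚ) :
    h.eval (MvPolynomial.C s) = h.baseEval s := by
  simp [eval]

theorem IsCoverData.eval_X_zero (h : IsCoverData C a β β') : (h.eval (X 0)).1 = β := by
  simp [eval]

theorem IsCoverData.eval_X_one (h : IsCoverData C a β β') : (h.eval (X 1)).1 = β' := by
  simp [eval]

theorem IsCoverData.baseEval_eq_mvEval (h : IsCoverData C a β β')
    (s : MvPolynomial (Fin N) ℚ) : (h.baseEval s).1 = mvEval a s := by
  have := mvEval_comp_X (C.evenCycles.val.comp h.baseEval) s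
  simp only [AlgHom.comp_apply, Subalgebra.coe_val] at this
  rw [← this]
  congr 1
  funext i
  simp [baseEval]

theorem IsCoverData.baseEval_mem (h : IsCoverData C a β β')
    (s : MvPolynomial (Fin N) ℚ) : (h.baseEval s).1 ∈ C.grading 0 := by
  induction s using MvPolynomial.induction_on with
  | C r =>
    rw [MvPolynomial.algHom_C, Algebra.algebraMap_eq_smul_one]
    exact Submodule.smul_mem _ _ C.one_mem
  | add p q hp hq =>
    rw [map_add]
    exact add_mem hp hq
  | mul_X p i hp =>
    rw [map_mul]
    have := C.mul_mem hp (h.a_mem i)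
    rw [add_zero] at this
    simpa [baseEval] using this

/-- The map `cover N → C` determined by its values on the generators. -/
noncomputable def IsCoverData.hom (h : IsCoverData C a β β') : Hom (cover N) C where
  toFun := C.evenCycles.val.comp h.eval.toRatAlgHom
  map_grading := by
    intro k (p : MvPolynomial (Fin 2) (MvPolynomial (Fin N) ℚ)) hp
    change (h.eval p).1 ∈ C.grading k
    rw [p.as_sum, map_sum, AddSubmonoidClass.coe_finsetSum]
    refine sum_mem fun α hα => ?_
    have hk := mem_cover_grading.1 hp (mem_support_iff.1 hα)
    rw [weight_coverWeight] at hk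
    rw [monomial_eq, Finsupp.prod_fintype _ _ (by simp), Fin.prod_univ_two, map_mul, map_mul,
      map_pow, map_pow, h.eval_C]
    have := C.mul_mem (h.baseEval_mem (p.coeff α))
      (C.mul_mem (C.pow_mem h.β_mem (α 0)) (C.pow_mem h.β'_mem (α 1)))
    convert this using 2
    · omega
    · simp [h.eval_X_zero, h.eval_X_one]
  map_d := fun p => by
    rw [cover_d]
    exact (map_zero _).trans (h.eval p).2.2.symm

theorem IsCoverData.hom_coverTerm (h : IsCoverData C a β β') (s : MvPolynomial (Fin N) ℚ)
    (k : ℤ) : h.hom.toFun (coverTerm s k) = mvEval a s * ipow β β' k := by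
  have hi := map_ipow (C.evenCycles.val.toRingHom.comp h.eval) (X 0) (X 1) k
  change (h.eval (coverTerm s k)).1 = _
  rw [coverTerm, map_mul, h.eval_C, ← h.baseEval_eq_mvEval]
  refine congrArg (_ * ·) (hi.trans ?_)
  exact congrArg₂ (ipow · · k) h.eval_X_zero h.eval_X_one

theorem IsCoverData.hom_invRel (h : IsCoverData C a β β') :
    h.hom.toFun (invRel N) = 1 - β * β' := by
  change (h.eval (invRel N)).1 = _
  rw [invRel, map_sub, map_one, map_mul]
  change 1 - (h.eval (X 0)).1 * (h.eval (X 1)).1 = _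
  rw [h.eval_X_zero, h.eval_X_one]

theorem IsCoverData.hom_mem (h : IsCoverData C a β β') {U : Subalgebra ℚ C.carrier}
    (ha : ∀ i, a i ∈ U) (hβ : β ∈ U) (hβ' : β' ∈ U) (p : (cover N).carrier) :
    h.hom.toFun p ∈ U := by
  change (h.eval p).1 ∈ U
  have hbase : ∀ s, (h.baseEval s).1 ∈ U := fun s => by
    induction s using MvPolynomial.induction_on with
    | C r =>
      rw [MvPolynomial.algHom_C]
      exact U.algebraMap_mem r
    | add p q hp hq =>
      rw [map_add]
      exact U.add_mem hp hq
    | mul_X p i hp =>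
      rw [map_mul]
      exact U.mul_mem hp (by simpa [baseEval] using ha i)
  induction p using MvPolynomial.induction_on with
  | C s =>
    rw [h.eval_C]
    exact hbase s
  | add p q hp hq =>
    rw [map_add]
    exact U.add_mem hp hq
  | mul_X p i hp =>
    rw [map_mul]
    refine U.mul_mem hp ?_
    fin_cases i
    · simpa [h.eval_X_zero] using hβ
    · simpa [h.eval_X_one] using hβ'

theorem IsCoverData.hom_sub_hom_mem (h : IsCoverData C a β β') {b : Fin N → C.carrier}
    {γ γ' : C.carrier} (h' : IsCoverData C b γ γ')
    (ha : ∀ i, a i - b i ∈ LinearMap.range C.d) (hβ : β - γ ∈ LinearMap.range C.d)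
    (hβ' : β' - γ' ∈ LinearMap.range C.d) (p : (cover N).carrier) :
    h.hom.toFun p - h'.hom.toFun p ∈ LinearMap.range C.d := by
  have key : (Ideal.Quotient.mk C.evenBoundaries).comp h.eval =
      (Ideal.Quotient.mk C.evenBoundaries).comp h'.eval := by
    refine ringHom_ext (fun s => ?_) (fun i => ?_)
    · rw [RingHom.comp_apply, RingHom.comp_apply, h.eval_C, h'.eval_C]
      change ((Ideal.Quotient.mkₐ ℚ C.evenBoundaries).comp h.baseEval) s =
        ((Ideal.Quotient.mkₐ ℚ C.evenBoundaries).comp h'.baseEval) s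
      congr 1
      refine MvPolynomial.algHom_ext fun i => ?_
      refine Ideal.Quotient.eq.2 ?_
      change (h.baseEval (X i)).1 - (h'.baseEval (X i)).1 ∈ LinearMap.range C.d
      simpa [baseEval] using ha i
    · refine Ideal.Quotient.eq.2 ?_
      change (h.eval (X i)).1 - (h'.eval (X i)).1 ∈ LinearMap.range C.d
      fin_cases i
      · simpa [h.eval_X_zero, h'.eval_X_zero] using hβ
      · simpa [h.eval_X_one, h'.eval_X_one] using hβ'
  exact Ideal.Quotient.eq.1 (RingHom.congr_fun key p)

end Eval

/-- The map `φ : cover N → C` exhibits `R[β^{±1}]` with `R = ℚ[x₁,…,x_N] / J` as the homology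
of `C`. -/
structure IsModel {C : CDGA} {N : ℕ} (J : Ideal (MvPolynomial (Fin N) ℚ))
    (φ : Hom (cover N) C) : Prop where
  odd : ∀ k, Odd k → ∀ x ∈ C.grading k, C.d x = 0 → x ∈ LinearMap.range C.d
  surj : ∀ k : ℤ, ∀ x ∈ C.grading (2 * k), C.d x = 0 →
    ∃ s, x - φ.toFun (coverTerm s k) ∈ LinearMap.range C.d
  ker : ∀ s k, φ.toFun (coverTerm s k) ∈ LinearMap.range C.d → s ∈ J

theorem IsModel.congr {C : CDGA} {N : ℕ} {J : Ideal (MvPolynomial (Fin N) ℚ)}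
    {φ ψ : Hom (cover N) C} (h : IsModel J φ)
    (hφψ : ∀ p, φ.toFun p - ψ.toFun p ∈ LinearMap.range C.d) : IsModel J ψ where
  odd := h.odd
  surj k x hx hdx := by
    obtain ⟨s, hs⟩ := h.surj k x hx hdx
    refine ⟨s, ?_⟩
    simpa using add_mem hs (hφψ (coverTerm s k))
  ker s k hs := h.ker s k (by simpa using add_mem (hφψ (coverTerm s k)) hs)

/-- The ideal of relations defining `R[β^{±1}]` as a quotient of `cover N`. -/
noncomputable def coverIdeal {N : ℕ} (J : Ideal (MvPolynomial (Fin N) ℚ)) :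
    Ideal (MvPolynomial (Fin 2) (MvPolynomial (Fin N) ℚ)) :=
  J.map MvPolynomial.C ⊔ Ideal.span {invRel N}

theorem Hom.sub_mem_range_d {P C D : CDGA} {φ : Hom P C} {ι : Hom P D} {f : Hom D C}
    (hf : ∀ p, f.toFun (ι.toFun p) = φ.toFun p) {x y : P.carrier}
    (h : ι.toFun (x - y) ∈ LinearMap.range D.d) :
    φ.toFun x - φ.toFun y ∈ LinearMap.range C.d := by
  rw [← map_sub, ← hf]
  exact f.map_mem_range_d h

theorem quasiIso_of_isModel {N : ℕ} {J : Ideal (MvPolynomial (Fin N) ℚ)} {D C : CDGA}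
    {φ : Hom (cover N) C} (hφ : IsModel J φ) {ι : Hom (cover N) D} {f : Hom D C}
    (hf : ∀ p, f.toFun (ι.toFun p) = φ.toFun p)
    (hsurj : ∀ x, D.d x = 0 → ∃ p, x - ι.toFun p ∈ LinearMap.range D.d)
    (hker : ∀ p : MvPolynomial (Fin 2) (MvPolynomial (Fin N) ℚ),
      ι.toFun p ∈ LinearMap.range D.d ↔ p ∈ coverIdeal J) : QuasiIso f := by
  refine quasiIso_of_cover hf (cover_d N) hsurj (fun k y hy hdy => ?_)
    (fun k (p : MvPolynomial (Fin 2) (MvPolynomial (Fin N) ℚ)) hp hφp => ?_)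
  · rcases Int.even_or_odd' k with ⟨j, rfl | rfl⟩
    · obtain ⟨s, hs⟩ := hφ.surj j y hy hdy
      exact ⟨_, coverTerm_mem s j, hs⟩
    · refine ⟨0, zero_mem _, ?_⟩
      simpa using hφ.odd _ ⟨j, rfl⟩ y hy hdy
  · rcases Int.even_or_odd' k with ⟨j, rfl | rfl⟩
    · obtain ⟨s, hs⟩ := exists_invRel_dvd_sub_coverTerm hp
      have h1 : (p - coverTerm s j : MvPolynomial (Fin 2) (MvPolynomial (Fin N) ℚ)) ∈
          coverIdeal J := Ideal.mem_sup_right (Ideal.mem_span_singleton.2 hs)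
      have h2 : φ.toFun p - φ.toFun (coverTerm s j) ∈ LinearMap.range C.d :=
        Hom.sub_mem_range_d hf ((hker _).2 h1)
      have h3 : φ.toFun (coverTerm s j) ∈ LinearMap.range C.d := by
        simpa using sub_mem hφp h2
      have h4 : coverTerm s j ∈ coverIdeal J :=
        Ideal.mul_mem_right _ _ (Ideal.mem_sup_left (Ideal.mem_map_of_mem _ (hφ.ker s j h3)))
      rw [hker]
      have := add_mem h1 h4
      rwa [sub_add_cancel] at this
    · have : p = 0 := by
        rw [cover_grading_odd N _ ⟨j, rfl⟩] at hp
        exact hp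
      exact ⟨0, by rw [map_zero, this]; exact (map_zero ι.toFun).symm⟩

section Laurent

open LaurentPolynomial

variable {R : Type} [CommRing R]

theorem eq_zero_of_mem_gradeBy_odd {k : ℤ} (hk : Odd k) {x : R[T;T⁻¹]}
    (hx : x ∈ AddMonoidAlgebra.gradeBy R (AddMonoidHom.mulLeft (2 : ℤ)) k) : x = 0 := by
  refine AddMonoidAlgebra.ext (Finsupp.ext fun n => ?_)
  by_contra h
  have := hx n (Finsupp.mem_support_iff.2 h)
  obtain ⟨m, rfl⟩ := hk
  rw [AddMonoidHom.coe_mulLeft] at this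
  omega

theorem C_mul_T_eq_zero {r : R} {k : ℤ} : (C r * T k : R[T;T⁻¹]) = 0 ↔ r = 0 := by
  rw [← single_eq_C_mul_T]
  exact AddMonoidAlgebra.single_eq_zero

theorem ipow_T (k : ℤ) : ipow (T 1 : R[T;T⁻¹]) (T (-1)) k = T k := by
  unfold ipow
  split_ifs with h
  · rw [T_pow]
    congr 1
    omega
  · rw [T_pow]
    congr 1
    omega

theorem T_one_mul_T_neg_one : (T 1 * T (-1) : R[T;T⁻¹]) = 1 := by
  rw [← T_add, add_neg_cancel, T_zero]

variable (R) [Algebra ℚ R]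

/-- The Laurent algebra `R[T;T⁻¹]` with `R` in degree `0` and `T` in degree `2`. -/
noncomputable def laurent : CDGA :=
  ofEven R[T;T⁻¹]
    (fun k => (AddMonoidAlgebra.gradeBy R (AddMonoidHom.mulLeft (2 : ℤ)) k).restrictScalars ℚ)
    (isInternal_restrictScalars (AddMonoidAlgebra.gradeBy.isInternal _))
    (SetLike.GradedOne.one_mem
      (A := AddMonoidAlgebra.gradeBy R (AddMonoidHom.mulLeft (2 : ℤ))))
    (fun hx hy => SetLike.GradedMul.mul_mem
      (A := AddMonoidAlgebra.gradeBy R (AddMonoidHom.mulLeft (2 : ℤ))) hx hy)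
    (fun k hk => by
      rw [eq_bot_iff]
      exact fun x hx => eq_zero_of_mem_gradeBy_odd hk hx)

variable {R}

theorem mem_laurent_grading {k : ℤ} {x : R[T;T⁻¹]} :
    x ∈ (laurent R).grading k ↔ ∀ n, n ∈ x.coeff.support → 2 * n = k := Iff.rfl

theorem laurent_grading_odd (R : Type) [CommRing R] [Algebra ℚ R] (k : ℤ) (hk : Odd k) :
    (laurent R).grading k = ⊥ := by
  rw [eq_bot_iff]
  exact fun x hx => eq_zero_of_mem_gradeBy_odd hk hx

theorem C_mul_T_mem (r : R) (k : ℤ) : (C r * T k : R[T;T⁻¹]) ∈ (laurent R).grading (2 * k) := by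
  rw [← single_eq_C_mul_T]
  exact AddMonoidAlgebra.single_mem_gradeBy (AddMonoidHom.mulLeft (2 : ℤ)) k r

theorem T_mem (k : ℤ) : (T k : R[T;T⁻¹]) ∈ (laurent R).grading (2 * k) := by
  simpa using C_mul_T_mem (1 : R) k

theorem C_mem_laurent (r : R) : (C r : R[T;T⁻¹]) ∈ (laurent R).grading 0 := by
  simpa using C_mul_T_mem r 0

theorem exists_eq_C_mul_T {k : ℤ} {x : R[T;T⁻¹]} (hx : x ∈ (laurent R).grading (2 * k)) :
    ∃ r, x = C r * T k := by
  refine ⟨x.coeff k, ?_⟩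
  rw [← single_eq_C_mul_T]
  refine AddMonoidAlgebra.ext (Finsupp.ext fun n => ?_)
  rw [AddMonoidAlgebra.coeff_single]
  rcases eq_or_ne k n with rfl | h
  · simp
  · rw [Finsupp.single_eq_of_ne' h]
    by_contra h'
    have := mem_laurent_grading.1 hx n (Finsupp.mem_support_iff.2 h')
    omega

theorem isCoverData_laurent {N : ℕ} (r : Fin N → R) :
    IsCoverData (laurent R) (fun i => (C (r i) : R[T;T⁻¹])) (T 1 : R[T;T⁻¹])
      (T (-1) : R[T;T⁻¹]) where
  a_mem _ := C_mem_laurent _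
  d_a _ := rfl
  β_mem := T_mem 1
  d_β := rfl
  β'_mem := T_mem (-1)
  d_β' := rfl

theorem mvEval_C_mk_mul_ipow {N : ℕ} (J : Ideal (MvPolynomial (Fin N) ℚ))
    (s : MvPolynomial (Fin N) ℚ) (k : ℤ) :
    mvEval (fun i => (C (Ideal.Quotient.mk J (MvPolynomial.X i)) :
      (MvPolynomial (Fin N) ℚ ⧸ J)[T;T⁻¹])) s * ipow (T 1) (T (-1)) k =
      C (Ideal.Quotient.mk J s) * T k := by
  rw [ipow_T]
  congr 1
  exact mvEval_comp_X
    ((((C : (MvPolynomial (Fin N) ℚ ⧸ J) →+* _).comp (Ideal.Quotient.mk J))).toRatAlgHom) s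

theorem isCoverData_laurent_hom {N : ℕ} (J : Ideal (MvPolynomial (Fin N) ℚ))
    (s : MvPolynomial (Fin N) ℚ) (k : ℤ) :
    (isCoverData_laurent fun i => Ideal.Quotient.mk J (MvPolynomial.X i)).hom.toFun
      (coverTerm s k) =
      (C (Ideal.Quotient.mk J s) * T k : (MvPolynomial (Fin N) ℚ ⧸ J)[T;T⁻¹]) :=
  (IsCoverData.hom_coverTerm _ s k).trans (mvEval_C_mk_mul_ipow J s k)

theorem isModel_laurent {N : ℕ} (J : Ideal (MvPolynomial (Fin N) ℚ)) :
    IsModel J (isCoverData_laurent fun i => Ideal.Quotient.mk J (MvPolynomial.X i)).hom where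
  odd k hk x hx _ := by
    rw [laurent_grading_odd _ k hk, Submodule.mem_bot] at hx
    rw [hx]
    exact zero_mem _
  surj k x hx _ := by
    obtain ⟨r, hr⟩ := exists_eq_C_mul_T hx
    obtain ⟨s, rfl⟩ := Ideal.Quotient.mk_surjective r
    exact ⟨s, 0, (map_zero _).trans
      (sub_eq_zero.2 (hr.trans (isCoverData_laurent_hom J s k).symm)).symm⟩
  ker s k := by
    rintro ⟨z, hz⟩
    have h : (C (Ideal.Quotient.mk J s) * T k : (MvPolynomial (Fin N) ℚ ⧸ J)[T;T⁻¹]) = 0 :=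
      (isCoverData_laurent_hom J s k).symm.trans hz.symm
    exact Ideal.Quotient.eq_zero_iff_mem.1 (C_mul_T_eq_zero.1 h)

end Laurent

section Average

variable {A : CDGA} {W : Type} [Group W] [Fintype W] (ρ : W →* (A.carrier ≃ₐ[ℚ] A.carrier))

/-- The subalgebra of invariants of an action. -/
def invariants : Subalgebra ℚ A.carrier where
  carrier := {x | ∀ w, ρ w x = x}
  mul_mem' hx hy w := by rw [map_mul, hx w, hy w]
  add_mem' hx hy w := by rw [map_add, hx w, hy w]
  algebraMap_mem' r w := (ρ w).commutes r

/-- The average over the action of a finite group. -/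
noncomputable def average : A.carrier →ₗ[ℚ] A.carrier :=
  (Fintype.card W : ℚ)⁻¹ • ∑ w, (ρ w).toLinearMap

theorem average_apply (x : A.carrier) :
    average ρ x = (Fintype.card W : ℚ)⁻¹ • ∑ w, ρ w x := by
  simp [average]

theorem average_mem_invariants (x : A.carrier) : average ρ x ∈ invariants ρ := by
  intro w
  rw [average_apply, map_smul, map_sum]
  congr 1
  refine Fintype.sum_equiv (Equiv.mulLeft w) _ _ fun v => ?_
  simp [map_mul]

theorem average_mem_grading (hρ : ∀ w i, ∀ x ∈ A.grading i, ρ w x ∈ A.grading i) {i : ℤ}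
    {x : A.carrier} (hx : x ∈ A.grading i) : average ρ x ∈ A.grading i := by
  rw [average_apply]
  exact Submodule.smul_mem _ _ (sum_mem fun w _ => hρ w i x hx)

theorem average_d (hρ : ∀ w x, ρ w (A.d x) = A.d (ρ w x)) (x : A.carrier) :
    average ρ (A.d x) = A.d (average ρ x) := by
  simp [average_apply, hρ]

theorem average_of_mem_invariants {x : A.carrier} (hx : x ∈ invariants ρ) :
    average ρ x = x := by
  rw [average_apply, Finset.sum_congr rfl fun w _ => hx w, Finset.sum_const, Finset.card_univ,
    ← Nat.cast_smul_eq_nsmul ℚ, smul_smul, inv_mul_cancel₀ (by simp), one_smul]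

theorem sub_average_mem {x : A.carrier} (hx : ∀ w, ρ w x - x ∈ LinearMap.range A.d) :
    x - average ρ x ∈ LinearMap.range A.d := by
  have h : average ρ x - x = (Fintype.card W : ℚ)⁻¹ • ∑ w, (ρ w x - x) := by
    rw [average_apply, Finset.sum_sub_distrib, smul_sub, Finset.sum_const, Finset.card_univ,
      ← Nat.cast_smul_eq_nsmul ℚ, smul_smul, inv_mul_cancel₀ (by simp), one_smul]
  rw [← neg_sub, h]
  exact neg_mem (Submodule.smul_mem _ _ (sum_mem fun w _ => hx w))

/-- An invariant boundary is the boundary of an invariant element. -/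
theorem exists_invariant_d_eq (hρd : ∀ w x, ρ w (A.d x) = A.d (ρ w x))
    (hρ : ∀ w i, ∀ x ∈ A.grading i, ρ w x ∈ A.grading i) {x : A.carrier}
    (hx : x ∈ A.grading 0) (hxρ : x ∈ invariants ρ) (hd : x ∈ LinearMap.range A.d) :
    ∃ z ∈ A.grading 1, z ∈ invariants ρ ∧ A.d z = x := by
  obtain ⟨z, hz, rfl⟩ := (A.isBoundary_iff hx).2 hd
  exact ⟨average ρ z, average_mem_grading ρ hρ hz, average_mem_invariants ρ z,
    by rw [← average_d ρ hρd, average_of_mem_invariants ρ hxρ]⟩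

end Average

section Resolution

variable {N : ℕ} {A L : CDGA} {φ : Hom (cover N) A} {π : Hom (cover N) L}
  {U : Subalgebra ℚ A.carrier}

/-- The elements of `cover N` lying in a given ideal. -/
def coverSet (I : Ideal (MvPolynomial (Fin 2) (MvPolynomial (Fin N) ℚ))) :
    Set (cover N).carrier :=
  (I : Set (MvPolynomial (Fin 2) (MvPolynomial (Fin N) ℚ)))

theorem HasResolution.sup_span {I : Ideal (MvPolynomial (Fin 2) (MvPolynomial (Fin N) ℚ))}
    (H : HasResolution φ π U (coverSet I)) {q : MvPolynomial (Fin 2) (MvPolynomial (Fin N) ℚ)}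
    (hq : q ∈ (cover N).grading 0) (hz : ∃ z ∈ A.grading 1, z ∈ U ∧ A.d z = φ.toFun q)
    (hπ : π.toFun q = 0) (hreg : ∀ p, p * q ∈ I → p ∈ I) :
    HasResolution φ π U (coverSet (I ⊔ Ideal.span {q})) := by
  obtain ⟨z, hz, hzU, hdz⟩ := hz
  refine H.adjoin (cover_d N) (cover_sgn N) hq hz hzU hdz hπ hreg
    fun (p : MvPolynomial (Fin 2) (MvPolynomial (Fin N) ℚ)) => ?_
  change p ∈ I ⊔ Ideal.span {q} ↔
    ∃ r, (p - r * q : MvPolynomial (Fin 2) (MvPolynomial (Fin N) ℚ)) ∈ I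
  rw [sup_comm, Ideal.mem_span_singleton_sup]
  constructor
  · rintro ⟨r, y, hy, rfl⟩
    exact ⟨r, by simpa using hy⟩
  · rintro ⟨r, hr⟩
    exact ⟨r, _, hr, by simp⟩

theorem hasResolution_coverIdeal {m : ℕ} {F : Fin m → MvPolynomial (Fin N) ℚ}
    (hF : IsRegularSeq F) (hU : ∀ p, φ.toFun p ∈ U)
    (hz : ∀ i, ∃ z ∈ A.grading 1, z ∈ U ∧ A.d z = φ.toFun
      (MvPolynomial.C (F i) : MvPolynomial (Fin 2) (MvPolynomial (Fin N) ℚ)))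
    (hπ : ∀ i, π.toFun
      (MvPolynomial.C (F i) : MvPolynomial (Fin 2) (MvPolynomial (Fin N) ℚ)) = 0)
    (hz' : ∃ z ∈ A.grading 1, z ∈ U ∧ A.d z = φ.toFun (invRel N))
    (hπ' : π.toFun (invRel N) = 0) :
    HasResolution φ π U (coverSet (coverIdeal (Ideal.span (Set.range F)))) := by
  refine HasResolution.sup_span ?_ (invRel_mem N) hz' hπ' fun p => mem_map_C_of_mul_invRel_mem
  have key : ∀ n ≤ m, HasResolution φ π U
      (coverSet ((Ideal.span (F '' {j | j.val < n})).map MvPolynomial.C)) := by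
    intro n
    induction n with
    | zero =>
      intro _
      have h := hasResolution_zero (cover_d N) φ π U hU
      convert h using 1
      simp
      rfl
    | succ n ih =>
      intro hn
      have h := (ih (by omega)).sup_span (C_mem (F ⟨n, hn⟩)) (hz _) (hπ _) fun p hp => by
        rw [MvPolynomial.mem_map_C_iff] at hp ⊢
        intro α
        have := hp α
        rw [mul_comm, MvPolynomial.coeff_C_mul] at this
        exact hF.2 ⟨n, hn⟩ _ this
      have hset : F '' {j | j.val < n + 1} = F '' {j | j.val < n} ∪ {F ⟨n, hn⟩} := by
        rw [← Set.image_singleton, ← Set.image_union]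
        congr 1
        ext j
        simp only [Set.mem_ofPred_eq, Set.mem_union, Set.mem_singleton_iff, Fin.ext_iff]
        omega
      rw [hset, Ideal.span_union, Ideal.map_sup, Ideal.map_span _ {F ⟨n, hn⟩},
        Set.image_singleton]
      exact h
  have h := key m le_rfl
  have hset : F '' {j | j.val < m} = Set.range F := by
    rw [← Set.image_univ]
    congr 1
    ext j
    simp
  rwa [hset] at h

end Resolution

end CDGA

/-- let `W` be a finite group, `R = ℚ[x₁,…,x_N]/(f₁,…,f_m)` the
quotient of a polynomial algebra by a regular sequence, and `A` a `ℚ[W]`-CDGA whose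
homology is isomorphic as a graded `ℚ[W]`-algebra to `R[β^{±1}]` with `|β| = 2`,
`R` in degree `0`, and trivial `W`-action.  Then `A` is formal as a `ℚ[W]`-CDGA:
there is a zig-zag of `W`-equivariant quasi-isomorphisms `A ← D → L` with `D`, `L`
carrying the trivial `W`-action, where `L` has zero differential and underlying
graded algebra `R[β^{±1}]`. -/
theorem laurent_regular_homology_equivariantly_formal
    (W : Type) [Group W] [Finite W] (N m : ℕ)
    (F : Fin m → MvPolynomial (Fin N) ℚ) (hreg : IsRegularSeq F)
    (A : CDGA) (ρ : W →* (A.carrier ≃ₐ[ℚ] A.carrier))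
    (hρd : ∀ (w : W) (x : A.carrier), ρ w (A.d x) = A.d (ρ w x))
    (hρg : ∀ (w : W) (i : ℤ), ∀ x ∈ A.grading i, ρ w x ∈ A.grading i)
    -- homology is R[β^{±1}] with R in degree 0 …
    (a : Fin N → A.carrier) (ha : ∀ i, a i ∈ A.grading 0 ∧ A.d (a i) = 0)
    (β β' : A.carrier) (hβ : β ∈ A.grading 2) (hβ' : β' ∈ A.grading (-2))
    (hdβ : A.d β = 0) (hdβ' : A.d β' = 0) (hββ' : A.IsBoundary 0 (β * β' - 1))
    (hodd : ∀ k : ℤ, ∀ x ∈ A.grading (2 * k + 1), A.d x = 0 →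
      A.IsBoundary (2 * k + 1) x)
    (hsurj : ∀ k : ℤ, ∀ x ∈ A.grading (2 * k), A.d x = 0 →
      ∃ p : MvPolynomial (Fin N) ℚ,
        A.IsBoundary (2 * k) (x - mvEval a p * ipow β β' k))
    (hker : ∀ (p : MvPolynomial (Fin N) ℚ) (k : ℤ),
      A.IsBoundary (2 * k) (mvEval a p * ipow β β' k) ↔
        p ∈ Ideal.span (Set.range F))
    -- … with trivial W-action
    (htriv : ∀ (w : W) (k : ℤ), ∀ x ∈ A.grading k, A.d x = 0 →
      A.IsBoundary k ((ρ w) x - x)) :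
    ∃ (D L : CDGA) (f : Hom D A) (g : Hom D L), QuasiIso f ∧ QuasiIso g ∧
      (∀ (w : W) (x : D.carrier), ρ w (f.toFun x) = f.toFun x) ∧
      L.d = 0 ∧
      (∃ (aL : Fin N → L.carrier) (βL βL' : L.carrier),
        (∀ i, aL i ∈ L.grading 0) ∧ βL ∈ L.grading 2 ∧ βL' ∈ L.grading (-2) ∧
        βL * βL' = 1 ∧
        (∀ k : ℤ, L.grading (2 * k + 1) = ⊥) ∧
        (∀ k : ℤ, ∀ x ∈ L.grading (2 * k),
          ∃ p : MvPolynomial (Fin N) ℚ, x = mvEval aL p * ipow βL βL' k) ∧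
        (∀ (p : MvPolynomial (Fin N) ℚ) (k : ℤ),
          mvEval aL p * ipow βL βL' k = 0 ↔ p ∈ Ideal.span (Set.range F))) := by
  cases nonempty_fintype W
  set J := Ideal.span (Set.range F) with hJ
  have hdata : IsCoverData A a β β' :=
    ⟨fun i => (ha i).1, fun i => (ha i).2, hβ, hdβ, hβ', hdβ'⟩
  have hb : ∀ s k, A.IsBoundary (2 * k) (mvEval a s * ipow β β' k) ↔
      hdata.hom.toFun (coverTerm s k) ∈ LinearMap.range A.d := fun s k => by
    rw [← hdata.hom_coverTerm]
    exact A.isBoundary_iff (hdata.hom.map_grading (coverTerm_mem s k))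
  have hmodel : IsModel J hdata.hom := by
    refine ⟨?_, fun k x hx hdx => ?_, fun s k h => (hker s k).1 ((hb s k).2 h)⟩
    · rintro _ ⟨k, rfl⟩ x hx hdx
      exact (A.isBoundary_iff hx).1 (hodd k x hx hdx)
    · obtain ⟨s, z, -, hz⟩ := hsurj k x hx hdx
      exact ⟨s, z, by rw [hz, ← hdata.hom_coverTerm]⟩
  have hav : ∀ {k : ℤ} {x : A.carrier}, x ∈ A.grading k → A.d x = 0 →
      x - average ρ x ∈ LinearMap.range A.d := fun {k x} hx hdx => by
    refine sub_average_mem ρ fun w => ?_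
    exact (A.isBoundary_iff (sub_mem (hρg w k x hx) hx)).1 (htriv w k x hx hdx)
  have hdav : ∀ {x : A.carrier}, A.d x = 0 → A.d (average ρ x) = 0 := fun hx => by
    rw [← average_d ρ hρd, hx, map_zero]
  have hdata' : IsCoverData A (fun i => average ρ (a i)) (average ρ β) (average ρ β') :=
    ⟨fun i => average_mem_grading ρ hρg (ha i).1, fun i => hdav (ha i).2,
      average_mem_grading ρ hρg hβ, hdav hdβ, average_mem_grading ρ hρg hβ', hdav hdβ'⟩
  have hcongr := hdata.hom_sub_hom_mem hdata' (fun i => hav (ha i).1 (ha i).2) (hav hβ hdβ)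
    (hav hβ' hdβ')
  have hmodel' := hmodel.congr hcongr
  have hinv : ∀ p, hdata'.hom.toFun p ∈ invariants ρ :=
    hdata'.hom_mem (fun i => average_mem_invariants ρ _) (average_mem_invariants ρ _)
      (average_mem_invariants ρ _)
  have hlift : ∀ q ∈ (cover N).grading 0, hdata.hom.toFun q ∈ LinearMap.range A.d →
      ∃ z ∈ A.grading 1, z ∈ invariants ρ ∧ A.d z = hdata'.hom.toFun q := fun q hq hd => by
    refine exists_invariant_d_eq ρ hρd hρg (hdata'.hom.map_grading hq) (hinv q) ?_
    simpa using sub_mem hd (hcongr q)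
  have hL := isModel_laurent J
  set hdataL := isCoverData_laurent fun i => Ideal.Quotient.mk J (MvPolynomial.X i)
  have hLzero : ∀ (s : MvPolynomial (Fin N) ℚ) (k : ℤ),
      hdataL.hom.toFun (coverTerm s k) = 0 ↔ s ∈ J := fun s k => by
    rw [← Ideal.Quotient.eq_zero_iff_mem, ← C_mul_T_eq_zero (k := k)]
    exact Eq.congr (isCoverData_laurent_hom J s k) rfl
  have hC : ∀ s : MvPolynomial (Fin N) ℚ, coverTerm s 0 = MvPolynomial.C s := fun s => by
    simp [coverTerm, ipow]
  obtain ⟨D, ι, f, g, H⟩ := hasResolution_coverIdeal (φ := hdata'.hom) (π := hdataL.hom) hreg hinv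
    (fun i => hlift _ (C_mem _) (by
      rw [← hC, ← hb, hker]
      exact Ideal.subset_span ⟨i, rfl⟩))
    (fun i => by
      rw [← hC, hLzero]
      exact Ideal.subset_span ⟨i, rfl⟩)
    (hlift _ (invRel_mem N) (by
      obtain ⟨z, -, hz⟩ := hββ'
      exact ⟨-z, by rw [map_neg, hz, hdata.hom_invRel, neg_sub]⟩))
    (by
      rw [hdataL.hom_invRel, sub_eq_zero]
      exact T_one_mul_T_neg_one.symm)
  refine ⟨D, laurent _, f, g, quasiIso_of_isModel hmodel' H.f_ι H.surj H.ker,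
    quasiIso_of_isModel hL H.g_ι H.surj H.ker, fun w x => H.f_mem x w, rfl,
    _, _, _, hdataL.a_mem, hdataL.β_mem, hdataL.β'_mem, T_one_mul_T_neg_one,
    fun k => laurent_grading_odd _ _ ⟨k, rfl⟩, fun k x hx => ?_, fun s k => ?_⟩
  · obtain ⟨s, z, hz⟩ := hL.surj k x hx rfl
    refine ⟨s, ?_⟩
    rw [← hdataL.hom_coverTerm, ← sub_eq_zero, ← hz]
    rfl
  · rw [← hdataL.hom_coverTerm, hLzero]
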